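/- Let a : 𝔽ₙ⁺ → ℂ and b : {α ∈ 𝔽ₙ⁺ : |α| ≥ 1} → ℂ. There exists a multi-Toeplitz operator A ∈ B(F²(Hₙ)) whose Fourier coefficients are exactly (a_α) and (b_α) if and only if both of the following hold: (i) Σ_{α ∈ 𝔽ₙ⁺} |a_α|² < ∞ and Σ_{|α| ≥ 1} |b_α|² < ∞; and (ii) for every r ∈ [0,1) the series φ_r := Σ_{k=1}^∞ Σ_{|α|=k} b_α r^k S_α* + a_{g₀} I + Σ_{k=1}^∞ Σ_{|α|=k} a_α r^k S_α converges in operator norm (which is automatic given (i)) and sup_{0 ≤ r < 1} ‖φ_r‖ < ∞. -/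

import Mathlib

open scoped ENNReal ComplexOrder
open Filter ContinuousLinearMap

noncomputable section

abbrev Word (n : ℕ) := FreeMonoid (Fin n)

/-- The word determined by a tuple of letters. -/
def word {n k : ℕ} (f : Fin k → Fin n) : Word n :=
  FreeMonoid.ofList (List.ofFn f)

/-- The length of a word. -/
def wordLen {n : ℕ} (α : Word n) : ℕ := (FreeMonoid.toList α).length

/-- The product `X_α = X_{i₁} ⋯ X_{i_k}` for `α = g_{i₁} ⋯ g_{i_k}`. -/
def wordProd {n : ℕ} {K : Type} [NormedAddCommGroup K] [InnerProductSpace ℂ K]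
    (X : Fin n → K →L[ℂ] K) (α : Word n) : K →L[ℂ] K :=
  ((FreeMonoid.toList α).map X).prod

/-- `Σ_{|α| = k} a_α X_α`. -/
def truncSum {n : ℕ} {K : Type} [NormedAddCommGroup K] [InnerProductSpace ℂ K]
    (a : Word n → ℂ) (X : Fin n → K →L[ℂ] K) (k : ℕ) : K →L[ℂ] K :=
  ∑ f : Fin k → Fin n, a (word f) • wordProd X (word f)

/-- `Σ_{|α| = k} b_α X_α*`. -/
def truncSumAdj {n : ℕ} {K : Type} [NormedAddCommGroup K] [InnerProductSpace ℂ K]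
    [CompleteSpace K] (b : Word n → ℂ) (X : Fin n → K →L[ℂ] K) (k : ℕ) : K →L[ℂ] K :=
  ∑ f : Fin k → Fin n, b (word f) • adjoint (wordProd X (word f))

/-- The free holomorphic function `f(X) = Σ_k Σ_{|α| = k} a_α X_α`. -/
def holOp {n : ℕ} {K : Type} [NormedAddCommGroup K] [InnerProductSpace ℂ K]
    (a : Word n → ℂ) (X : Fin n → K →L[ℂ] K) : K →L[ℂ] K :=
  ∑' k : ℕ, truncSum a X k

/-- The free pluriharmonic function
`u(X) = Σ_{k ≥ 1} Σ_{|α| = k} b_α X_α* + a_{g₀} I + Σ_{k ≥ 1} Σ_{|α| = k} a_α X_α`. -/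
def phOp {n : ℕ} {K : Type} [NormedAddCommGroup K] [InnerProductSpace ℂ K]
    [CompleteSpace K] (a b : Word n → ℂ) (X : Fin n → K →L[ℂ] K) : K →L[ℂ] K :=
  (∑' k : ℕ, truncSumAdj b X (k + 1)) + a 1 • (1 : K →L[ℂ] K)
    + ∑' k : ℕ, truncSum a X (k + 1)

/-- Membership in the open noncommutative ball of radius `γ`. -/
def inBall {n : ℕ} {K : Type} [NormedAddCommGroup K] [InnerProductSpace ℂ K]
    [CompleteSpace K] (γ : ℝ) (X : Fin n → K →L[ℂ] K) : Prop :=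
  ‖∑ i, X i * adjoint (X i)‖ < γ ^ 2

/-- Membership in the closed noncommutative ball of radius `γ`. -/
def inClosedBall {n : ℕ} {K : Type} [NormedAddCommGroup K] [InnerProductSpace ℂ K]
    [CompleteSpace K] (γ : ℝ) (X : Fin n → K →L[ℂ] K) : Prop :=
  ‖∑ i, X i * adjoint (X i)‖ ≤ γ ^ 2

/-- The radius-`γ` condition `limsup_k (Σ_{|α|=k} |a_α|²)^{1/(2k)} ≤ 1/γ`. -/
def radCond {n : ℕ} (γ : ℝ) (a : Word n → ℂ) : Prop :=
  Filter.limsup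
    (fun k : ℕ =>
      (∑ f : Fin k → Fin n, (‖a (word f)‖₊ : ℝ≥0∞) ^ 2) ^ ((1 : ℝ) / (2 * (k : ℝ))))
    Filter.atTop ≤ ENNReal.ofReal (1 / γ)

/-- The coefficients of the radial function: `α ↦ r^{|α|} a_α`. -/
def scaleCoef {n : ℕ} (r : ℝ) (a : Word n → ℂ) : Word n → ℂ :=
  fun α => ((r : ℂ) ^ wordLen α) * a α

/-- Positivity of the free pluriharmonic function with coefficients `(a, b)` on the
noncommutative ball of radius `γ` of every complex Hilbert space. -/
def posPH {n : ℕ} (γ : ℝ) (a b : Word n → ℂ) : Prop :=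
  ∀ (K : Type) [NormedAddCommGroup K] [InnerProductSpace ℂ K] [CompleteSpace K],
    ∀ X : Fin n → K →L[ℂ] K, inBall γ X → (phOp a b X).IsPositive


open scoped Topology InnerProductSpace

section General

variable {F : Type*} [NormedAddCommGroup F] [InnerProductSpace ℂ F]

/-- Along an ultrafilter, a bounded sequence of operators converges in the weak operator topology. -/
lemma exists_weak_limit [CompleteSpace F] (U : Ultrafilter ℕ) (T : ℕ → F →L[ℂ] F) (M : ℝ)
    (hT : ∀ k, ‖T k‖ ≤ M) :
    ∃ A : F →L[ℂ] F, ∀ x y : F,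
      Tendsto (fun k => ⟪T k x, y⟫_ℂ) U (𝓝 ⟪A x, y⟫_ℂ) := by
  have bound : ∀ x y k, ‖⟪T k x, y⟫_ℂ‖ ≤ M * ‖x‖ * ‖y‖ := fun x y k =>
    (norm_inner_le_norm _ _).trans <| mul_le_mul_of_nonneg_right
      ((T k).le_of_opNorm_le (hT k) x) (norm_nonneg _)
  have conv : ∀ x y, ∃ z, ‖z‖ ≤ M * ‖x‖ * ‖y‖ ∧
      Tendsto (fun k => ⟪T k x, y⟫_ℂ) U (𝓝 z) := by
    intro x y
    obtain ⟨z, hz, hlim⟩ := (isCompact_closedBall (0 : ℂ) (M * ‖x‖ * ‖y‖)).ultrafilter_le_nhds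
      (U.map fun k => ⟪T k x, y⟫_ℂ)
      (le_principal_iff.2 (mem_map.2 (Eventually.of_forall fun k => by
        simpa using bound x y k)))
    exact ⟨z, by simpa using hz, hlim⟩
  choose B hB hlim using conv
  let L : F →ₗ⋆[ℂ] F →ₗ[ℂ] ℂ := LinearMap.mk₂'ₛₗ (starRingEnd ℂ) (RingHom.id ℂ) B
    (fun x x' y => tendsto_nhds_unique (hlim _ _) <| by
      simpa [inner_add_left] using (hlim x y).add (hlim x' y))
    (fun c x y => tendsto_nhds_unique (hlim _ _) <| by
      simpa only [map_smul, inner_smul_left, smul_eq_mul] using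
        (hlim x y).const_mul (starRingEnd ℂ c))
    (fun x y y' => tendsto_nhds_unique (hlim _ _) <| by
      simpa [inner_add_right] using (hlim x y).add (hlim x y'))
    (fun c x y => tendsto_nhds_unique (hlim _ _) <| by
      simpa [inner_smul_right] using (hlim x y).const_mul c)
  refine ⟨InnerProductSpace.continuousLinearMapOfBilin (L.mkContinuous₂ M hB), fun x y => ?_⟩
  rw [InnerProductSpace.continuousLinearMapOfBilin_apply]
  exact hlim x y

variable {ι : Type*} (e : HilbertBasis ι ℂ F)

lemma clm_ext_of_matrix {T T' : F →L[ℂ] F}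
    (h : ∀ α β, ⟪e α, T (e β)⟫_ℂ = ⟪e α, T' (e β)⟫_ℂ) : T = T' := by
  have hb : ∀ β, T (e β) = T' (e β) := fun β => by
    apply e.repr.injective
    ext α
    simp only [e.repr_apply_apply, h]
  refine ContinuousLinearMap.ext_on (s := Set.range e)
    (Submodule.dense_iff_topologicalClosure_eq_top.2 e.dense_span) ?_
  rintro _ ⟨β, rfl⟩
  exact hb β

lemma norm_sq_sum_smul_basis (s : Finset ι) (c : ι → ℂ) :
    ‖∑ α ∈ s, c α • e α‖ ^ 2 = ∑ α ∈ s, ‖c α‖ ^ 2 := by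
  have h : ∀ i, (starRingEnd ℂ) (c i) * c i = ((‖c i‖ ^ 2 : ℝ) : ℂ) := fun i => by
    rw [Complex.conj_mul']; simp
  rw [← inner_self_eq_norm_sq (𝕜 := ℂ), e.orthonormal.inner_sum]
  simp only [h, ← Complex.ofReal_sum]
  exact Complex.ofReal_re _

lemma inner_sum_smul_basis (T : F →L[ℂ] F) (s : Finset ι) (c d : ι → ℂ) :
    ⟪∑ α ∈ s, c α • e α, T (∑ β ∈ s, d β • e β)⟫_ℂ =
      ∑ α ∈ s, ∑ β ∈ s, starRingEnd ℂ (c α) * d β * ⟪e α, T (e β)⟫_ℂ := by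
  rw [sum_inner]
  refine Finset.sum_congr rfl fun α _ => ?_
  simp only [map_sum, map_smul, inner_sum, inner_smul_left, inner_smul_right, mul_assoc]
  exact Finset.sum_congr rfl fun β _ => mul_left_comm _ _ _

lemma norm_inner_schur_le {A T : F →L[ℂ] F} {κ : ι → ι → ℝ} {v : ℕ → ι → ℝ} {ℓ : ι → ℕ}
    (hv : ∀ N α β, ℓ α < N → ℓ β < N → ∑ m ∈ Finset.range N, v m α * v m β = κ α β)
    (hκ : ∀ α, κ α α = 1)
    (hT : ∀ α β, ⟪e α, T (e β)⟫_ℂ = κ α β * ⟪e α, A (e β)⟫_ℂ) (s : Finset ι) (c d : ι → ℂ) :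
    ‖⟪∑ α ∈ s, c α • e α, T (∑ β ∈ s, d β • e β)⟫_ℂ‖ ≤
      ‖A‖ * ‖∑ α ∈ s, c α • e α‖ * ‖∑ β ∈ s, d β • e β‖ := by
  set N := s.sup ℓ + 1 with hN
  have hlt : ∀ α ∈ s, ℓ α < N := fun α hα => Nat.lt_succ_of_le (Finset.le_sup hα)
  let x : (ι → ℂ) → ℕ → F := fun c m => ∑ α ∈ s, ((v m α : ℂ) * c α) • e α
  have hx : ∀ c, ∑ m ∈ Finset.range N, ‖x c m‖ ^ 2 = ‖∑ α ∈ s, c α • e α‖ ^ 2 := by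
    intro c
    simp only [x, norm_sq_sum_smul_basis]
    rw [Finset.sum_comm]
    refine Finset.sum_congr rfl fun α hα => ?_
    have h := hv N α α (hlt α hα) (hlt α hα)
    rw [hκ] at h
    calc _ = (∑ m ∈ Finset.range N, v m α * v m α) * ‖c α‖ ^ 2 := by
            rw [Finset.sum_mul]
            refine Finset.sum_congr rfl fun m _ => ?_
            rw [norm_mul, mul_pow, Complex.norm_real, Real.norm_eq_abs, sq_abs, sq (v m α)]
      _ = _ := by rw [h, one_mul]
  have hsum : ⟪∑ α ∈ s, c α • e α, T (∑ β ∈ s, d β • e β)⟫_ℂ =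
      ∑ m ∈ Finset.range N, ⟪x c m, A (x d m)⟫_ℂ := by
    simp only [x, inner_sum_smul_basis]
    symm
    rw [Finset.sum_comm]
    refine Finset.sum_congr rfl fun α hα => ?_
    rw [Finset.sum_comm]
    refine Finset.sum_congr rfl fun β hβ => ?_
    rw [hT, ← hv N α β (hlt α hα) (hlt β hβ)]
    push_cast
    rw [Finset.sum_mul, Finset.mul_sum]
    refine Finset.sum_congr rfl fun m _ => ?_
    simp only [map_mul, Complex.conj_ofReal]
    ring
  calc _ ≤ ∑ m ∈ Finset.range N, ‖⟪x c m, A (x d m)⟫_ℂ‖ := by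
          rw [hsum]; exact norm_sum_le _ _
    _ ≤ ∑ m ∈ Finset.range N, ‖A‖ * (‖x c m‖ * ‖x d m‖) := by
          refine Finset.sum_le_sum fun m _ => (norm_inner_le_norm _ _).trans ?_
          calc _ ≤ ‖x c m‖ * (‖A‖ * ‖x d m‖) := by gcongr; exact A.le_opNorm _
            _ = _ := by ring
    _ = ‖A‖ * ∑ m ∈ Finset.range N, ‖x c m‖ * ‖x d m‖ := by rw [Finset.mul_sum]
    _ ≤ ‖A‖ * (√(∑ m ∈ Finset.range N, ‖x c m‖ ^ 2) * √(∑ m ∈ Finset.range N, ‖x d m‖ ^ 2)) := by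
          gcongr; exact Real.sum_mul_le_sqrt_mul_sqrt _ _ _
    _ = _ := by
          rw [hx, hx, Real.sqrt_sq (norm_nonneg _), Real.sqrt_sq (norm_nonneg _), mul_assoc]

/-- A Schur multiplier whose symbol is a Gram kernel of unit vectors is contractive. -/
lemma norm_schur_le {A T : F →L[ℂ] F} {κ : ι → ι → ℝ} {v : ℕ → ι → ℝ} {ℓ : ι → ℕ}
    (hv : ∀ N α β, ℓ α < N → ℓ β < N → ∑ m ∈ Finset.range N, v m α * v m β = κ α β)
    (hκ : ∀ α, κ α α = 1)
    (hT : ∀ α β, ⟪e α, T (e β)⟫_ℂ = κ α β * ⟪e α, A (e β)⟫_ℂ) : ‖T‖ ≤ ‖A‖ := by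
  refine opNorm_le_of_re_inner_le (norm_nonneg _) fun x y hx hy => ?_
  have hlim : ∀ z : F, Tendsto (fun s : Finset ι => ∑ α ∈ s, e.repr z α • e α) atTop (𝓝 z) :=
    fun z => e.hasSum_repr z
  have key : ‖⟪y, T x⟫_ℂ‖ ≤ ‖A‖ * ‖y‖ * ‖x‖ :=
    le_of_tendsto_of_tendsto' ((hlim y).inner ((T.continuous.tendsto x).comp (hlim x))).norm
      (((hlim y).norm.const_mul ‖A‖).mul (hlim x).norm)
      fun s => norm_inner_schur_le e hv hκ hT s _ _
  rw [hx, hy, mul_one, mul_one, norm_inner_symm] at key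
  exact (RCLike.re_le_norm _).trans key

end General

section Kernel

lemma sum_geometric_kernel (r : ℝ) (i p : ℕ) :
    ∑ m ∈ Finset.range (i + 1), (if m = 0 then 1 else 1 - r ^ 2) * (r ^ (i - m) * r ^ (i + p - m))
      = r ^ p := by
  induction i with
  | zero => simp
  | succ i ih =>
    rw [Finset.sum_range_succ]
    have h : ∀ m ∈ Finset.range (i + 1),
        (if m = 0 then 1 else 1 - r ^ 2) * (r ^ (i + 1 - m) * r ^ (i + 1 + p - m)) =
        r ^ 2 * ((if m = 0 then 1 else 1 - r ^ 2) * (r ^ (i - m) * r ^ (i + p - m))) := by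
      intro m hm
      rw [Finset.mem_range] at hm
      rw [show i + 1 - m = (i - m) + 1 by omega, show i + 1 + p - m = (i + p - m) + 1 by omega]
      ring
    rw [Finset.sum_congr rfl h, ← Finset.mul_sum, ih]
    simp
    ring

/-- The `m`-th coordinate of the unit vector `v_i` in the Gram representation
`r ^ |i - j| = ⟪v_i, v_j⟫`. -/
def gramVec (r : ℝ) (m i : ℕ) : ℝ :=
  if m ≤ i then √(if m = 0 then 1 else 1 - r ^ 2) * r ^ (i - m) else 0

lemma sum_gramVec {r : ℝ} (hr0 : 0 ≤ r) (hr1 : r < 1) (N i j : ℕ) (hi : i < N) (hj : j < N) :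
    ∑ m ∈ Finset.range N, gramVec r m i * gramVec r m j = r ^ ((i - j) + (j - i)) := by
  wlog h : i ≤ j generalizing i j
  · simpa only [mul_comm, add_comm] using this j i hj hi (by omega)
  obtain ⟨p, rfl⟩ := Nat.exists_eq_add_of_le h
  rw [show i - (i + p) + (i + p - i) = p by omega, ← sum_geometric_kernel r i p,
    ← Finset.sum_subset (s₁ := Finset.range (i + 1))]
  · refine Finset.sum_congr rfl fun m hm => ?_
    rw [Finset.mem_range] at hm
    have hw : (0 : ℝ) ≤ if m = 0 then 1 else 1 - r ^ 2 := by
      split_ifs <;> nlinarith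
    rw [gramVec, gramVec, if_pos (show m ≤ i by omega), if_pos (show m ≤ i + p by omega),
      mul_mul_mul_comm,
      Real.mul_self_sqrt hw]
  · exact Finset.range_subset_range.2 (by omega)
  · intro m _ hm
    rw [Finset.mem_range] at hm
    rw [gramVec, if_neg (by omega), zero_mul]

end Kernel

section Words

variable {n : ℕ}

@[simp] lemma wordLen_one : wordLen (1 : Word n) = 0 := rfl

@[simp] lemma wordLen_mul (α β : Word n) : wordLen (α * β) = wordLen α + wordLen β := by
  simp [wordLen]

@[simp] lemma wordLen_of (i : Fin n) : wordLen (FreeMonoid.of i) = 1 := rfl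

@[simp] lemma wordLen_word {k : ℕ} (f : Fin k → Fin n) : wordLen (word f) = k := by
  simp [wordLen, word]

lemma word_injective {k : ℕ} : Function.Injective (word : (Fin k → Fin n) → Word n) :=
  fun _ _ h => List.ofFn_injective (FreeMonoid.ofList.injective h)

lemma exists_word_eq (α : Word n) : ∃ f : Fin (wordLen α) → Fin n, word f = α :=
  ⟨(FreeMonoid.toList α).get, by simp [word, wordLen]⟩

lemma word_mul_inj {k : ℕ} {f g : Fin k → Fin n} {α β : Word n} :
    word f * α = word g * β ↔ f = g ∧ α = β := by
  refine ⟨fun h => ?_, by rintro ⟨rfl, rfl⟩; rfl⟩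
  have h' := congrArg FreeMonoid.toList h
  simp only [FreeMonoid.toList_mul] at h'
  obtain ⟨h1, h2⟩ := List.append_inj h' (by simp [word])
  exact ⟨word_injective (FreeMonoid.toList.injective h1), FreeMonoid.toList.injective h2⟩

lemma mul_of_inj {α β : Word n} {i j : Fin n} :
    α * FreeMonoid.of i = β * FreeMonoid.of j ↔ α = β ∧ i = j := by
  refine ⟨fun h => ?_, by rintro ⟨rfl, rfl⟩; rfl⟩
  have h' := congrArg FreeMonoid.toList h
  simp only [FreeMonoid.toList_mul, FreeMonoid.toList_of] at h'
  obtain ⟨h1, h2⟩ := List.append_inj' h' rfl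
  exact ⟨FreeMonoid.toList.injective h1, by simpa using h2⟩

lemma eq_one_or_eq_mul_of (α : Word n) : α = 1 ∨ ∃ β i, α = β * FreeMonoid.of i := by
  rcases List.eq_nil_or_concat (FreeMonoid.toList α) with h | ⟨l, i, h⟩
  · exact Or.inl (FreeMonoid.toList.injective h)
  · exact Or.inr ⟨FreeMonoid.ofList l, i, FreeMonoid.toList.injective (by simpa using h)⟩

/-- A multi-Toeplitz matrix is determined by its first row and column. -/
lemma toeplitz_matrix_ext {f g : Word n → Word n → ℂ}
    (hf : ∀ α β i j, f (α * FreeMonoid.of i) (β * FreeMonoid.of j) = if i = j then f α β else 0)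
    (hg : ∀ α β i j, g (α * FreeMonoid.of i) (β * FreeMonoid.of j) = if i = j then g α β else 0)
    (hcol : ∀ α, f α 1 = g α 1) (hrow : ∀ β, 1 ≤ wordLen β → f 1 β = g 1 β) (α β : Word n) :
    f α β = g α β := by
  induction hk : wordLen β generalizing α β with
  | zero =>
    rcases eq_one_or_eq_mul_of β with rfl | ⟨β, j, rfl⟩
    · exact hcol α
    · simp at hk
  | succ k ih =>
    rcases eq_one_or_eq_mul_of β with rfl | ⟨β, j, rfl⟩
    · exact hcol α
    rcases eq_one_or_eq_mul_of α with rfl | ⟨α, i, rfl⟩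
    · exact hrow _ (by omega)
    · rw [hf, hg, ih α β (by simpa using hk)]

end Words

lemma tsum_succ_eq_ite {m : ℕ} (z : ℂ) :
    ∑' k : ℕ, (if k + 1 = m then z else 0) = if 1 ≤ m then z else 0 := by
  rcases m with _ | m <;> simp

section MultiToeplitz

variable {n : ℕ} {F : Type} [NormedAddCommGroup F] [InnerProductSpace ℂ F] [CompleteSpace F]

/-- The space of multi-Toeplitz operators with respect to `R`. -/
def multiToeplitz (R : Fin n → F →L[ℂ] F) : Submodule ℂ (F →L[ℂ] F) where
  carrier := {T | ∀ i j, adjoint (R i) * T * R j = if i = j then T else 0}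
  zero_mem' := by simp
  add_mem' {T T'} hT hT' i j := by
    rw [mul_add, add_mul, hT, hT']
    split_ifs <;> simp
  smul_mem' c T hT i j := by
    rw [mul_smul_comm, smul_mul_assoc, hT]
    split_ifs <;> simp

lemma mem_multiToeplitz {R : Fin n → F →L[ℂ] F} {T : F →L[ℂ] F} :
    T ∈ multiToeplitz R ↔ ∀ i j, adjoint (R i) * T * R j = if i = j then T else 0 := Iff.rfl

lemma isClosed_multiToeplitz (R : Fin n → F →L[ℂ] F) :
    IsClosed (multiToeplitz R : Set (F →L[ℂ] F)) := by
  have h : (multiToeplitz R : Set (F →L[ℂ] F)) =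
      ⋂ i, ⋂ j, {T | adjoint (R i) * T * R j = if i = j then T else 0} := by
    ext T; simp [mem_multiToeplitz]
  rw [h]
  refine isClosed_iInter fun i => isClosed_iInter fun j => isClosed_eq (by fun_prop) ?_
  split_ifs <;> fun_prop

lemma adjoint_mem_multiToeplitz {R : Fin n → F →L[ℂ] F} {T : F →L[ℂ] F}
    (hT : T ∈ multiToeplitz R) : adjoint T ∈ multiToeplitz R := by
  intro i j
  have h := congrArg star (hT j i)
  rw [star_mul, star_mul, ← star_eq_adjoint, star_star, ← mul_assoc] at h
  rw [← star_eq_adjoint, ← star_eq_adjoint, h]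
  by_cases hij : i = j
  · rw [if_pos hij, if_pos hij.symm]
  · rw [if_neg hij, if_neg (Ne.symm hij), star_zero]

end MultiToeplitz

section Fock

open scoped Classical

variable {n : ℕ} {F : Type} [NormedAddCommGroup F] [InnerProductSpace ℂ F]
  {e : HilbertBasis (Word n) ℂ F} {S R : Fin n → F →L[ℂ] F}

lemma inner_basis (e : HilbertBasis (Word n) ℂ F) (α β : Word n) :
    ⟪e α, e β⟫_ℂ = if α = β then 1 else 0 :=
  orthonormal_iff_ite.1 e.orthonormal α β

lemma wordProd_basis (hS : ∀ (i : Fin n) (α : Word n), S i (e α) = e (FreeMonoid.of i * α))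
    (α β : Word n) : wordProd S α (e β) = e (α * β) := by
  induction α using FreeMonoid.inductionOn' with
  | one => simp [wordProd]
  | of_mul i α ih =>
    have h : wordProd S (FreeMonoid.of i * α) = S i * wordProd S α := by
      simp [wordProd]
    rw [h, mul_apply_eq_comp, ih, hS, mul_assoc]

lemma inner_truncSum_basis (hS : ∀ (i : Fin n) (α : Word n), S i (e α) = e (FreeMonoid.of i * α))
    (c : Word n → ℂ) (k : ℕ) (α β : Word n) :
    ⟪e α, truncSum c S k (e β)⟫_ℂ =
      ∑ f : Fin k → Fin n, if α = word f * β then c (word f) else 0 := by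
  simp [truncSum, sum_apply, wordProd_basis hS, inner_basis]

lemma inner_truncSum_one (hS : ∀ (i : Fin n) (α : Word n), S i (e α) = e (FreeMonoid.of i * α))
    (c : Word n → ℂ) (k : ℕ) (α : Word n) :
    ⟪e α, truncSum c S k (e 1)⟫_ℂ = if k = wordLen α then c α else 0 := by
  simp only [inner_truncSum_basis hS, mul_one]
  split_ifs with h
  · subst h
    obtain ⟨f, hf⟩ := exists_word_eq α
    rw [Finset.sum_eq_single f _ (by simp), if_pos hf.symm, hf]
    intro g _ hg
    rw [if_neg]
    exact fun h => hg (word_injective (h.symm.trans hf.symm))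
  · refine Finset.sum_eq_zero fun f _ => if_neg ?_
    rintro rfl
    simp at h

lemma inner_one_truncSum (hS : ∀ (i : Fin n) (α : Word n), S i (e α) = e (FreeMonoid.of i * α))
    (c : Word n → ℂ) (k : ℕ) (β : Word n) :
    ⟪e 1, truncSum c S (k + 1) (e β)⟫_ℂ = 0 := by
  rw [inner_truncSum_basis hS]
  refine Finset.sum_eq_zero fun f _ => if_neg fun h => ?_
  have hlen := congrArg wordLen h
  simp only [wordLen_one, wordLen_mul, wordLen_word] at hlen
  omega

lemma truncSum_scaleCoef (r : ℝ) (c : Word n → ℂ) (k : ℕ) :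
    truncSum (scaleCoef r c) S k = (r : ℂ) ^ k • truncSum c S k := by
  simp [truncSum, scaleCoef, Finset.smul_sum, smul_smul]

lemma inner_tsum_apply {T : ℕ → F →L[ℂ] F} (hT : Summable T) (x y : F) :
    ⟪x, (∑' k, T k) y⟫_ℂ = ∑' k, ⟪x, T k y⟫_ℂ :=
  (innerSL ℂ x ∘L ContinuousLinearMap.apply ℂ F y).map_tsum hT

variable [CompleteSpace F]

lemma truncSumAdj_eq_adjoint (b : Word n → ℂ) (k : ℕ) :
    truncSumAdj b S k = adjoint (truncSum (fun α => starRingEnd ℂ (b α)) S k) := by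
  simp [truncSum, truncSumAdj, map_sum, map_smulₛₗ]

lemma truncSumAdj_scaleCoef (r : ℝ) (c : Word n → ℂ) (k : ℕ) :
    truncSumAdj (scaleCoef r c) S k = (r : ℂ) ^ k • truncSumAdj c S k := by
  simp [truncSumAdj, scaleCoef, Finset.smul_sum, smul_smul]

lemma inner_truncSumAdj (c : Word n → ℂ) (k : ℕ) (x y : F) :
    ⟪x, truncSumAdj c S k y⟫_ℂ =
      starRingEnd ℂ ⟪y, truncSum (fun α => starRingEnd ℂ (c α)) S k x⟫_ℂ := by
  rw [truncSumAdj_eq_adjoint, adjoint_inner_right, inner_conj_symm]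

lemma adjoint_wordProd_mul (hS : ∀ (i : Fin n) (α : Word n), S i (e α) = e (FreeMonoid.of i * α))
    {k : ℕ} (f g : Fin k → Fin n) :
    adjoint (wordProd S (word f)) * wordProd S (word g) = if f = g then 1 else 0 := by
  refine clm_ext_of_matrix e fun α β => ?_
  rw [mul_apply_eq_comp, adjoint_inner_right, wordProd_basis hS, wordProd_basis hS, inner_basis]
  simp only [word_mul_inj]
  by_cases h : f = g <;> simp [h, inner_basis]

lemma norm_truncSum_sq_le
    (hS : ∀ (i : Fin n) (α : Word n), S i (e α) = e (FreeMonoid.of i * α))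
    (c : Word n → ℂ) (k : ℕ) :
    ‖truncSum c S k‖ ^ 2 ≤ ∑ f : Fin k → Fin n, ‖c (word f)‖ ^ 2 := by
  have h : star (truncSum c S k) * truncSum c S k =
      ((∑ f : Fin k → Fin n, ‖c (word f)‖ ^ 2 : ℝ) : ℂ) • (1 : F →L[ℂ] F) := by
    simp only [truncSum, star_sum, star_smul, Finset.sum_mul_sum, smul_mul_smul_comm,
      star_eq_adjoint, adjoint_wordProd_mul hS]
    simp only [smul_ite, smul_zero, Finset.sum_ite_eq, Finset.mem_univ, if_true]
    rw [← Finset.sum_smul]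
    simp [Complex.conj_mul']
  have h0 : 0 ≤ ∑ f : Fin k → Fin n, ‖c (word f)‖ ^ 2 := by positivity
  rw [sq, ← CStarRing.norm_star_mul_self, h, norm_smul, Complex.norm_real, Real.norm_of_nonneg h0]
  exact mul_le_of_le_one_right h0 norm_id_le

lemma adjoint_right_mul (hR : ∀ (i : Fin n) (α : Word n), R i (e α) = e (α * FreeMonoid.of i))
    (i j : Fin n) : adjoint (R i) * R j = if i = j then 1 else 0 := by
  refine clm_ext_of_matrix e fun α β => ?_
  rw [mul_apply_eq_comp, adjoint_inner_right, hR, hR, inner_basis]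
  simp only [mul_of_inj]
  by_cases h : i = j <;> simp [h, inner_basis]

lemma one_mem_multiToeplitz
    (hR : ∀ (i : Fin n) (α : Word n), R i (e α) = e (α * FreeMonoid.of i)) :
    1 ∈ multiToeplitz R := fun i j => by rw [mul_one, adjoint_right_mul hR]

lemma truncSum_mem_multiToeplitz
    (hS : ∀ (i : Fin n) (α : Word n), S i (e α) = e (FreeMonoid.of i * α))
    (hR : ∀ (i : Fin n) (α : Word n), R i (e α) = e (α * FreeMonoid.of i))
    (c : Word n → ℂ) (k : ℕ) : truncSum c S k ∈ multiToeplitz R := by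
  refine Submodule.sum_mem _ fun f _ => Submodule.smul_mem _ _ fun i j => ?_
  have h : wordProd S (word f) * R j = R j * wordProd S (word f) :=
    clm_ext_of_matrix e fun α β => by
      simp only [mul_apply_eq_comp, hR, wordProd_basis hS, mul_assoc]
  rw [mul_assoc, h, ← mul_assoc, adjoint_right_mul hR]
  split_ifs <;> simp

lemma phOp_mem_multiToeplitz
    (hS : ∀ (i : Fin n) (α : Word n), S i (e α) = e (FreeMonoid.of i * α))
    (hR : ∀ (i : Fin n) (α : Word n), R i (e α) = e (α * FreeMonoid.of i))
    (a b : Word n → ℂ) : phOp a b S ∈ multiToeplitz R := by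
  refine Submodule.add_mem _ (Submodule.add_mem _ (tsum_mem (isClosed_multiToeplitz R) fun k => ?_)
    (Submodule.smul_mem _ _ (one_mem_multiToeplitz hR)))
    (tsum_mem (isClosed_multiToeplitz R) fun k => truncSum_mem_multiToeplitz hS hR a _)
  rw [truncSumAdj_eq_adjoint]
  exact adjoint_mem_multiToeplitz (truncSum_mem_multiToeplitz hS hR _ _)

lemma inner_mul_of_of_mem (hR : ∀ (i : Fin n) (α : Word n), R i (e α) = e (α * FreeMonoid.of i))
    {T : F →L[ℂ] F} (hT : T ∈ multiToeplitz R) (α β : Word n) (i j : Fin n) :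
    ⟪e (α * FreeMonoid.of i), T (e (β * FreeMonoid.of j))⟫_ℂ =
      if i = j then ⟪e α, T (e β)⟫_ℂ else 0 := by
  rw [← hR, ← hR, ← adjoint_inner_right]
  change ⟪e α, (adjoint (R i) * T * R j) (e β)⟫_ℂ = _
  rw [hT i j]
  split_ifs <;> simp

section Coefficients

variable {a b : Word n → ℂ}

lemma inner_phOp (x y : F)
    (ha : Summable fun k => truncSum a S (k + 1))
    (hb : Summable fun k => truncSumAdj b S (k + 1)) :
    ⟪x, phOp a b S y⟫_ℂ = ∑' k, ⟪x, truncSumAdj b S (k + 1) y⟫_ℂ + a 1 * ⟪x, y⟫_ℂ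
      + ∑' k, ⟪x, truncSum a S (k + 1) y⟫_ℂ := by
  simp only [phOp, add_apply, inner_add_right, inner_tsum_apply ha, inner_tsum_apply hb,
    smul_apply, one_apply_eq_self, inner_smul_right]

lemma inner_phOp_one (hS : ∀ (i : Fin n) (α : Word n), S i (e α) = e (FreeMonoid.of i * α))
    (ha : Summable fun k => truncSum a S (k + 1))
    (hb : Summable fun k => truncSumAdj b S (k + 1)) (α : Word n) :
    ⟪e α, phOp a b S (e 1)⟫_ℂ = a α := by
  simp only [inner_phOp _ _ ha hb, inner_truncSumAdj, inner_one_truncSum hS,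
    inner_truncSum_one hS, tsum_succ_eq_ite, inner_basis]
  rcases eq_one_or_eq_mul_of α with rfl | ⟨α, i, rfl⟩
  · simp
  · have h : α * FreeMonoid.of i ≠ 1 := fun h => by simpa using congrArg wordLen h
    simp [h]

lemma inner_one_phOp (hS : ∀ (i : Fin n) (α : Word n), S i (e α) = e (FreeMonoid.of i * α))
    (ha : Summable fun k => truncSum a S (k + 1))
    (hb : Summable fun k => truncSumAdj b S (k + 1)) (β : Word n) (hβ : 1 ≤ wordLen β) :
    ⟪e 1, phOp a b S (e β)⟫_ℂ = b β := by
  have h : (1 : Word n) ≠ β := by rintro rfl; simp at hβ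
  simp [inner_phOp _ _ ha hb, inner_truncSumAdj, inner_one_truncSum hS,
    inner_truncSum_one hS, apply_ite, tsum_succ_eq_ite, inner_basis, h, hβ]

end Coefficients

lemma summable_smul_pow_of_norm_le {T : ℕ → F →L[ℂ] F} {C r : ℝ} (hT : ∀ k, ‖T k‖ ^ 2 ≤ C)
    (hr0 : 0 ≤ r) (hr1 : r < 1) : Summable fun k => (r : ℂ) ^ (k + 1) • T k := by
  refine Summable.of_norm_bounded
    (((summable_geometric_of_lt_one hr0 hr1).mul_left r).mul_right √C) fun k => ?_
  rw [norm_smul, norm_pow, Complex.norm_real, Real.norm_of_nonneg hr0, pow_succ']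
  gcongr
  exact Real.le_sqrt_of_sq_le (hT k)

lemma summable_truncSum_scaleCoef
    (hS : ∀ (i : Fin n) (α : Word n), S i (e α) = e (FreeMonoid.of i * α)) {c : Word n → ℂ}
    (hc : Summable fun β : {α : Word n // 1 ≤ wordLen α} => ‖c β‖ ^ 2)
    {r : ℝ} (hr0 : 0 ≤ r) (hr1 : r < 1) :
    Summable fun k => truncSum (scaleCoef r c) S (k + 1) := by
  simp only [truncSum_scaleCoef]
  refine summable_smul_pow_of_norm_le (C := ∑' β : {α : Word n // 1 ≤ wordLen α}, ‖c β‖ ^ 2)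
    (fun k => (norm_truncSum_sq_le hS c _).trans ?_) hr0 hr1
  let w : (Fin (k + 1) → Fin n) → {α : Word n // 1 ≤ wordLen α} := fun f => ⟨word f, by simp⟩
  have hw : Function.Injective w := fun f g h => word_injective (congrArg Subtype.val h)
  rw [← tsum_fintype (L := .unconditional _)]
  exact (hc.comp_injective hw).tsum_le_tsum_of_inj w hw (fun _ _ => by positivity)
    (fun _ => le_rfl) hc

lemma summable_truncSumAdj_scaleCoef
    (hS : ∀ (i : Fin n) (α : Word n), S i (e α) = e (FreeMonoid.of i * α)) {c : Word n → ℂ}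
    (hc : Summable fun β : {α : Word n // 1 ≤ wordLen α} => ‖c β‖ ^ 2)
    {r : ℝ} (hr0 : 0 ≤ r) (hr1 : r < 1) :
    Summable fun k => truncSumAdj (scaleCoef r c) S (k + 1) := by
  have h := summable_truncSum_scaleCoef hS (c := fun α => starRingEnd ℂ (c α))
    (by simpa using hc) hr0 hr1
  have h' := h.map (adjoint (𝕜 := ℂ) (E := F) (F := F)) (LinearIsometryEquiv.continuous _)
  refine h'.congr fun k => ?_
  simp [truncSumAdj_eq_adjoint, scaleCoef, truncSum]

/-- The radial operators of a multi-Toeplitz operator are bounded by its norm. -/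
lemma norm_phOp_scaleCoef_le
    (hS : ∀ (i : Fin n) (α : Word n), S i (e α) = e (FreeMonoid.of i * α))
    (hR : ∀ (i : Fin n) (α : Word n), R i (e α) = e (α * FreeMonoid.of i))
    {a b : Word n → ℂ} {A : F →L[ℂ] F} (hA : A ∈ multiToeplitz R)
    (hAa : ∀ α, ⟪e α, A (e 1)⟫_ℂ = a α) (hAb : ∀ α, 1 ≤ wordLen α → ⟪e 1, A (e α)⟫_ℂ = b α)
    {r : ℝ} (hr0 : 0 ≤ r) (hr1 : r < 1)
    (ha : Summable fun k => truncSum (scaleCoef r a) S (k + 1))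
    (hb : Summable fun k => truncSumAdj (scaleCoef r b) S (k + 1)) :
    ‖phOp (scaleCoef r a) (scaleCoef r b) S‖ ≤ ‖A‖ := by
  refine norm_schur_le e (ℓ := wordLen) (v := fun m α => gramVec r m (wordLen α))
    (κ := fun α β => r ^ ((wordLen α - wordLen β) + (wordLen β - wordLen α)))
    (fun N α β => sum_gramVec hr0 hr1 N _ _) (by simp) ?_
  refine toeplitz_matrix_ext
    (fun α β i j => inner_mul_of_of_mem hR (phOp_mem_multiToeplitz hS hR _ _) α β i j)
    (fun α β i j => ?_) (fun α => ?_) (fun β hβ => ?_)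
  · rw [inner_mul_of_of_mem hR hA]
    simp
  · rw [inner_phOp_one hS ha hb, hAa]
    simp [scaleCoef]
  · rw [inner_one_phOp hS ha hb β hβ, hAb β hβ]
    simp [scaleCoef]

/-- A multi-Toeplitz operator with prescribed coefficients is a weak limit of bounded radial
operators. -/
lemma exists_multiToeplitz_of_bounded
    (hS : ∀ (i : Fin n) (α : Word n), S i (e α) = e (FreeMonoid.of i * α))
    (hR : ∀ (i : Fin n) (α : Word n), R i (e α) = e (α * FreeMonoid.of i))
    {a b : Word n → ℂ} {M : ℝ}
    (hs : ∀ r : ℝ, 0 ≤ r → r < 1 →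
      Summable (fun k : ℕ => truncSumAdj (scaleCoef r b) S (k + 1)) ∧
      Summable (fun k : ℕ => truncSum (scaleCoef r a) S (k + 1)))
    (hM : ∀ r : ℝ, 0 ≤ r → r < 1 → ‖phOp (scaleCoef r a) (scaleCoef r b) S‖ ≤ M) :
    ∃ A ∈ multiToeplitz R, (∀ α, ⟪e α, A (e 1)⟫_ℂ = a α) ∧
      ∀ α, 1 ≤ wordLen α → ⟪e 1, A (e α)⟫_ℂ = b α := by
  let ρ : ℕ → ℝ := fun k => 1 - 1 / ((k : ℝ) + 1)
  have hρ0 : ∀ k, 0 ≤ ρ k := fun k => sub_nonneg.2 <|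
    (div_le_one (by positivity)).2 (by simp)
  have hρ1 : ∀ k, ρ k < 1 := fun k => sub_lt_self _ (by positivity)
  have hρ : Tendsto ρ (hyperfilter ℕ : Filter ℕ) (𝓝 1) := by
    have h := (tendsto_one_div_add_atTop_nhds_zero_nat (𝕜 := ℝ)).const_sub 1
    rw [sub_zero] at h
    exact h.mono_left Nat.hyperfilter_le_atTop
  let φ : ℕ → F →L[ℂ] F := fun k => phOp (scaleCoef (ρ k) a) (scaleCoef (ρ k) b) S
  obtain ⟨A, hA⟩ := exists_weak_limit (hyperfilter ℕ) φ M fun k => hM _ (hρ0 k) (hρ1 k)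
  have hA' : ∀ x y, Tendsto (fun k => ⟪x, φ k y⟫_ℂ) (hyperfilter ℕ : Filter ℕ)
      (𝓝 ⟪x, A y⟫_ℂ) := fun x y => by
    simpa only [Function.comp_def, inner_conj_symm] using
      (Complex.continuous_conj.tendsto _).comp (hA y x)
  have hcoef : ∀ (c : Word n → ℂ) (α : Word n),
      Tendsto (fun k => scaleCoef (ρ k) c α) (hyperfilter ℕ : Filter ℕ) (𝓝 (c α)) := by
    intro c α
    simpa [scaleCoef] using
      (((Complex.continuous_ofReal.tendsto _).comp hρ).pow (wordLen α)).mul_const (c α)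
  refine ⟨A, fun i j => ?_, fun α => ?_, fun α hα => ?_⟩
  · refine ContinuousLinearMap.ext fun y => ext_inner_left ℂ fun x => ?_
    rw [mul_apply_eq_comp, mul_apply_eq_comp, adjoint_inner_right]
    refine tendsto_nhds_unique (hA' (R i x) (R j y)) ?_
    have h : ∀ k, ⟪R i x, φ k (R j y)⟫_ℂ = ⟪x, (if i = j then φ k else 0) y⟫_ℂ := fun k => by
      rw [← phOp_mem_multiToeplitz hS hR (scaleCoef (ρ k) a) (scaleCoef (ρ k) b) i j,
        mul_apply_eq_comp, mul_apply_eq_comp, adjoint_inner_right]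
    simp only [h]
    split_ifs
    · exact hA' x y
    · simp
  · refine tendsto_nhds_unique (hA' _ _) ((hcoef a α).congr fun k => ?_)
    obtain ⟨hb, ha⟩ := hs _ (hρ0 k) (hρ1 k)
    exact (inner_phOp_one hS ha hb α).symm
  · refine tendsto_nhds_unique (hA' _ _) ((hcoef b α).congr fun k => ?_)
    obtain ⟨hb, ha⟩ := hs _ (hρ0 k) (hρ1 k)
    exact (inner_one_phOp hS ha hb α hα).symm

end Fock

/-- Characterization of the Fourier coefficient sequences of multi-Toeplitz
operators: square-summability together with uniform boundedness of the radial operators. -/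
theorem stmt_1 (n : ℕ) (hn : 1 ≤ n)
    (F : Type) [NormedAddCommGroup F] [InnerProductSpace ℂ F] [CompleteSpace F]
    (e : HilbertBasis (Word n) ℂ F)
    (S R : Fin n → F →L[ℂ] F)
    (hS : ∀ (i : Fin n) (α : Word n), S i (e α) = e (FreeMonoid.of i * α))
    (hR : ∀ (i : Fin n) (α : Word n), R i (e α) = e (α * FreeMonoid.of i))
    (a b : Word n → ℂ) :
    (∃ A : F →L[ℂ] F,
        (∀ i j : Fin n, adjoint (R i) ∘L A ∘L R j = if i = j then A else 0) ∧
        (∀ α : Word n, (inner ℂ (e α) (A (e 1)) : ℂ) = a α) ∧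
        (∀ α : Word n, 1 ≤ wordLen α → (inner ℂ (e 1) (A (e α)) : ℂ) = b α)) ↔
    ((Summable fun α : Word n => ‖a α‖ ^ 2) ∧
      (Summable fun β : {α : Word n // 1 ≤ wordLen α} => ‖b (β : Word n)‖ ^ 2) ∧
      (∀ r : ℝ, 0 ≤ r → r < 1 →
        Summable (fun k : ℕ => truncSumAdj (scaleCoef r b) S (k + 1)) ∧
        Summable (fun k : ℕ => truncSum (scaleCoef r a) S (k + 1))) ∧
      (∃ M : ℝ, ∀ r : ℝ, 0 ≤ r → r < 1 →
        ‖phOp (scaleCoef r a) (scaleCoef r b) S‖ ≤ M)) := by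
  have hmem : ∀ A : F →L[ℂ] F,
      (∀ i j : Fin n, adjoint (R i) ∘L A ∘L R j = if i = j then A else 0) ↔
        A ∈ multiToeplitz R := fun A => Iff.rfl
  constructor
  · rintro ⟨A, hA, hAa, hAb⟩
    have ha : Summable fun α : Word n => ‖a α‖ ^ 2 := by
      simpa only [hAa] using e.orthonormal.inner_products_summable (A (e 1))
    have hb : Summable fun β : {α : Word n // 1 ≤ wordLen α} => ‖b (β : Word n)‖ ^ 2 := by
      refine ((e.orthonormal.inner_products_summable (adjoint A (e 1))).subtype
        {α | 1 ≤ wordLen α}).congr fun β => ?_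
      rw [← hAb β.1 β.2, ← adjoint_inner_left, norm_inner_symm]
      rfl
    have hs : ∀ r : ℝ, 0 ≤ r → r < 1 →
        Summable (fun k : ℕ => truncSumAdj (scaleCoef r b) S (k + 1)) ∧
        Summable (fun k : ℕ => truncSum (scaleCoef r a) S (k + 1)) := fun r hr0 hr1 =>
      ⟨summable_truncSumAdj_scaleCoef hS hb hr0 hr1,
        summable_truncSum_scaleCoef hS (ha.subtype _) hr0 hr1⟩
    exact ⟨ha, hb, hs, ‖A‖, fun r hr0 hr1 => norm_phOp_scaleCoef_le hS hR ((hmem A).1 hA) hAa hAb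
      hr0 hr1 (hs r hr0 hr1).2 (hs r hr0 hr1).1⟩
  · rintro ⟨-, -, hs, M, hM⟩
    obtain ⟨A, hA, hAa, hAb⟩ := exists_multiToeplitz_of_bounded hS hR hs hM
    exact ⟨A, (hmem A).2 hA, hAa, hAb⟩

end
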